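/- arXiv:0812.1280 — 2 statements merged into one kernel-verified Lean document; each statement's English description precedes it below -/
import Mathlib

section
/- Let P be a poset and n a positive integer. Let N(P) be the MacNeille completion of P, realized as the set {A : Set P | ∃ X : Set P, A = ⋂ x ∈ X, {y | y ≤ x}} ordered by inclusion (the empty intersection being all of P). Then the following are equivalent: (i) there exist linear orders r 1, …, r n on P, none admitting an order embedding of ℚ, with a ≤ b ↔ ∀ i, r i a b; (ii) there exist linearly ordered types C 1, …, C n, none admitting an order embedding of ℚ, and an order embedding of N(P) into the product order on C 1 × ⋯ × C n. Moreover, if these conditions hold, then the topological closure of N(P) in the Cantor space of subsets of P is topologically scattered. -/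
universe u

/-- A relation on `α` is scattered when there is no order embedding of `ℚ` into it. -/
def NoRatEmbedRel {α : Type*} (r : α → α → Prop) : Prop :=
  ¬ ∃ f : ℚ → α, ∀ q q' : ℚ, q ≤ q' ↔ r (f q) (f q')

/-- The MacNeille completion of a poset, realized as the set of all intersections of
families of principal down-sets. -/
def MacNeille (α : Type*) [PartialOrder α] : Set (Set α) :=
  {A : Set α | ∃ X : Set α, A = ⋂ x ∈ X, {y | y ≤ x}}

/-- Identification of the powerset of `α` with the Cantor space `α → Bool`. -/
noncomputable def chi {α : Type*} (A : Set α) : α → Bool :=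
  fun x => @decide (x ∈ A) (Classical.propDecidable _)

/-- A subset of a topological space is (topologically) scattered if every nonempty
subset of it contains a point isolated in that subset. -/
def TopScattered {X : Type*} [TopologicalSpace X] (C : Set X) : Prop :=
  ∀ S ⊆ C, S.Nonempty → ∃ a ∈ S, ∃ U : Set X, IsOpen U ∧ U ∩ S = {a}

section Scattered

theorem noRatEmbedRel_le_iff {β : Type*} [LinearOrder β] :
    NoRatEmbedRel (fun x y : β => x ≤ y) ↔ IsEmpty (ℚ ↪o β) := by
  constructor
  · exact fun h => ⟨fun f => h ⟨f, fun q q' => f.le_iff_le.symm⟩⟩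
  · rintro ⟨h⟩ ⟨f, hf⟩
    exact h (OrderEmbedding.ofMapLEIff f fun q q' => (hf q q').symm)

/-- The chain of lower sets of a scattered chain is scattered. -/
theorem isEmpty_rat_orderEmbedding_lowerSet {β : Type*} [LinearOrder β] (h : IsEmpty (ℚ ↪o β)) :
    IsEmpty (ℚ ↪o LowerSet β) := by
  refine ⟨fun f => ?_⟩
  have : Countable (ℚ ×ₗ Bool) := inferInstanceAs (Countable (ℚ × Bool))
  obtain ⟨g⟩ := Order.embedding_from_countable_to_dense (α := ℚ ×ₗ Bool) (β := ℚ)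
  have hlt (q : ℚ) : f (g (toLex (q, false))) < f (g (toLex (q, true))) := by
    simp [Prod.Lex.toLex_lt_toLex]
  choose x hx hx' using fun q => Set.not_subset.1 (not_le_of_gt (hlt q))
  refine h.elim (OrderEmbedding.ofStrictMono x fun q q' hq => ?_)
  have hle : f (g (toLex (q, true))) ≤ f (g (toLex (q', false))) := by
    simp [Prod.Lex.toLex_le_toLex, hq]
  by_contra! hxx
  exact hx' q' ((f (g (toLex (q', false)))).lower hxx (hle (hx q)))

/-- A nonempty chain without points isolated from both sides contains a copy of `ℚ`. -/
theorem nonempty_rat_orderEmbedding {L : Type*} [LinearOrder L] [Nonempty L]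
    (h : ∀ y : L, ¬ ((IsMin y ∨ ∃ w, w ⋖ y) ∧ (IsMax y ∨ ∃ z, y ⋖ z))) : Nonempty (ℚ ↪o L) := by
  let T := {y : L // ∀ w, ¬ w ⋖ y}
  have mem_of_covBy {w z : L} (hwz : w ⋖ z) : ∀ v, ¬ v ⋖ w := fun v hv =>
    h w ⟨.inr ⟨v, hv⟩, .inr ⟨z, hwz⟩⟩
  have exists_lt {x y : L} (hxy : x < y) (hy : ∀ w, ¬ w ⋖ y) : ∃ z, x < z ∧ z < y := by
    simpa using (not_covBy_iff hxy).1 (hy x)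
  have : DenselyOrdered T := by
    refine ⟨fun ⟨x, hx⟩ ⟨y, hy⟩ hxy => ?_⟩
    have hxy : x < y := hxy
    suffices ∃ z, (∀ w, ¬ w ⋖ z) ∧ x < z ∧ z < y from
      let ⟨z, hz, hz'⟩ := this
      ⟨⟨z, hz⟩, hz'⟩
    have key (z : L) (hz : x < z) (hzy : z < y) (hxz : ¬ x ⋖ z) :
        ∃ z, (∀ w, ¬ w ⋖ z) ∧ x < z ∧ z < y := by
      by_cases hT : ∀ w, ¬ w ⋖ z
      · exact ⟨z, hT, hz, hzy⟩
      · push Not at hT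
        obtain ⟨w, hw⟩ := hT
        refine ⟨w, mem_of_covBy hw, lt_of_le_of_ne (hw.le_of_lt hz) ?_, hw.lt.trans hzy⟩
        rintro rfl
        exact hxz hw
    obtain ⟨z, hz, hzy⟩ := exists_lt hxy hy
    by_cases hxz : x ⋖ z
    · obtain ⟨z', hz', hzy'⟩ := exists_lt hzy hy
      exact key z' (hz.trans hz') hzy' fun hc => hc.2 hz hz'
    · exact key z hz hzy hxz
  have : Nontrivial T := by
    have ret (z : L) : ∃ t : T, t.1 = z ∨ t.1 ⋖ z := by
      by_cases hT : ∀ w, ¬ w ⋖ z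
      · exact ⟨⟨z, hT⟩, .inl rfl⟩
      · push Not at hT
        obtain ⟨w, hw⟩ := hT
        exact ⟨⟨w, mem_of_covBy hw⟩, .inr hw⟩
    by_contra hT
    rw [not_nontrivial_iff_subsingleton] at hT
    obtain ⟨t, -⟩ := ret (Classical.arbitrary L)
    have ht (z : L) : t.1 = z ∨ t.1 ⋖ z := by
      obtain ⟨t', ht'⟩ := ret z
      rwa [Subsingleton.elim t t']
    refine h t.1 ⟨.inl fun z _ => ?_, ?_⟩
    · rcases ht z with hz | hz
      exacts [hz.le, hz.le]
    · by_cases hmax : IsMax t.1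
      · exact .inl hmax
      · obtain ⟨z, hz⟩ := not_isMax_iff.1 hmax
        exact .inr ⟨z, (ht z).resolve_left hz.ne⟩
  obtain ⟨f⟩ := Order.embedding_from_countable_to_dense (α := ℚ) (β := T)
  exact ⟨f.trans (OrderEmbedding.subtype _)⟩

end Scattered

section Topology

theorem TopScattered.mono {X : Type*} [TopologicalSpace X] {C D : Set X} (hD : TopScattered D)
    (h : C ⊆ D) : TopScattered C := fun S hS => hD S (hS.trans h)

theorem TopScattered.pi {ι : Type*} [Finite ι] {X : ι → Type*} [∀ i, TopologicalSpace (X i)]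
    {K : ∀ i, Set (X i)} (h : ∀ i, TopScattered (K i)) : TopScattered (Set.univ.pi K) := by
  classical
  have := Fintype.ofFinite ι
  intro S hS hne
  have key (s : Finset ι) : ∃ U : Set (∀ i, X i), IsOpen U ∧ (U ∩ S).Nonempty ∧
      ∀ x ∈ U ∩ S, ∀ y ∈ U ∩ S, ∀ i ∈ s, x i = y i := by
    induction s using Finset.induction_on with
    | empty => exact ⟨Set.univ, isOpen_univ, by simpa using hne, by simp⟩
    | insert i s _ ih =>
      obtain ⟨U, hU, hUS, heq⟩ := ih
      obtain ⟨_, ⟨x, hx, rfl⟩, V, hV, hVx⟩ := h i ((fun x => x i) '' (U ∩ S))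
        (by rintro _ ⟨x, hx, rfl⟩; exact hS hx.2 i trivial) (hUS.image _)
      have hmem (y) (hy : y ∈ U ∩ S) (hyV : y i ∈ V) : y i = x i := by
        have : y i ∈ V ∩ (fun x => x i) '' (U ∩ S) := ⟨hyV, y, hy, rfl⟩
        rwa [hVx] at this
      have hxV : x i ∈ V := (hVx.ge (Set.mem_singleton _)).1
      refine ⟨U ∩ (fun x => x i) ⁻¹' V, hU.inter (hV.preimage (continuous_apply i)),
        ⟨x, ⟨hx.1, hxV⟩, hx.2⟩, ?_⟩
      rintro y ⟨⟨hyU, hyV⟩, hyS⟩ z ⟨⟨hzU, hzV⟩, hzS⟩ j hj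
      rcases Finset.mem_insert.1 hj with rfl | hj
      · rw [hmem y ⟨hyU, hyS⟩ hyV, hmem z ⟨hzU, hzS⟩ hzV]
      · exact heq y ⟨hyU, hyS⟩ z ⟨hzU, hzS⟩ j hj
  obtain ⟨U, hU, ⟨a, ha⟩, heq⟩ := key Finset.univ
  refine ⟨a, ha.2, U, hU, Set.eq_singleton_iff_unique_mem.2 ⟨ha, fun x hx => ?_⟩⟩
  exact funext fun i => heq x hx a ha i (Finset.mem_univ i)

/-- Inside a compact set mapping onto a superset of `S`, there is a minimal closed set
mapping onto a superset of `S`. -/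
theorem exists_minimal_isClosed_subset_image {X Y : Type*} [TopologicalSpace X]
    [TopologicalSpace Y] [T2Space X] [T1Space Y] {K : Set X} (hK : IsCompact K) {F : X → Y}
    (hF : Continuous F) {S : Set Y} (hS : S ⊆ F '' K) :
    ∃ M, Minimal (· ∈ {M : Set X | IsClosed M ∧ M ⊆ K ∧ S ⊆ F '' M}) M := by
  suffices H : ∀ c ⊆ {M : Set X | IsClosed M ∧ M ⊆ K ∧ S ⊆ F '' M}, IsChain (· ⊆ ·) c →
      c.Nonempty → ∃ lb ∈ {M : Set X | IsClosed M ∧ M ⊆ K ∧ S ⊆ F '' M}, ∀ s ∈ c, lb ⊆ s by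
    obtain ⟨M, -, hM⟩ := zorn_superset_nonempty _ H K ⟨hK.isClosed, subset_rfl, hS⟩
    exact ⟨M, hM⟩
  intro c hc hchain hne
  refine ⟨⋂₀ c, ⟨isClosed_sInter fun M hM => (hc hM).1, ?_, fun s hs => ?_⟩,
    fun M hM => Set.sInter_subset_of_mem hM⟩
  · obtain ⟨M, hM⟩ := hne
    exact (Set.sInter_subset_of_mem hM).trans (hc hM).2.1
  have : Nonempty c := hne.to_subtype
  have hcl (M : c) : IsClosed (M.1 ∩ F ⁻¹' {s}) :=
    (hc M.2).1.inter (isClosed_singleton.preimage hF)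
  obtain ⟨x, hx⟩ := IsCompact.nonempty_iInter_of_directed_nonempty_isCompact_isClosed
    (fun M : c => M.1 ∩ F ⁻¹' {s})
    (fun M N => by
      rcases hchain.total M.2 N.2 with h | h
      · exact ⟨M, subset_rfl, Set.inter_subset_inter_left _ h⟩
      · exact ⟨N, Set.inter_subset_inter_left _ h, subset_rfl⟩)
    (fun M => by
      obtain ⟨x, hx, hxs⟩ := (hc M.2).2.2 hs
      exact ⟨x, hx, hxs⟩)
    (fun M => hK.of_isClosed_subset (hcl M) (Set.inter_subset_left.trans (hc M.2).2.1))
    hcl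
  rw [Set.mem_iInter] at hx
  exact ⟨x, fun M hM => (hx ⟨M, hM⟩).1, (hx ⟨_, hne.some_mem⟩).2⟩

theorem TopScattered.image {X Y : Type*} [TopologicalSpace X] [TopologicalSpace Y] [T2Space X]
    [T2Space Y] {K : Set X} (hK : IsCompact K) (h : TopScattered K) {F : X → Y}
    (hF : Continuous F) : TopScattered (F '' K) := by
  intro S hS hne
  obtain ⟨M, hM⟩ := exists_minimal_isClosed_subset_image hK hF hS
  obtain ⟨hMcl, hMK, hMS⟩ := hM.prop
  obtain ⟨x, hx, U, hU, hUM⟩ := h M hMK (Set.image_nonempty.1 (hne.mono hMS))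
  have hxU : x ∈ U := (hUM.ge (Set.mem_singleton x)).1
  have hcl : IsClosed (M \ U) := hMcl.sdiff hU
  have hnot : ¬ S ⊆ F '' (M \ U) := fun hsub =>
    (hM.le_of_le (y := M \ U) ⟨hcl, Set.sdiff_subset.trans hMK, hsub⟩ Set.sdiff_subset hx).2 hxU
  have huniq (s : Y) (hs : s ∈ S) (hsn : s ∉ F '' (M \ U)) : s = F x := by
    obtain ⟨k, hk, rfl⟩ := hMS hs
    have hkU : k ∈ U := by
      by_contra hkU
      exact hsn ⟨k, ⟨hk, hkU⟩, rfl⟩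
    have : k ∈ U ∩ M := ⟨hkU, hk⟩
    rw [hUM] at this
    rw [Set.mem_singleton_iff.1 this]
  obtain ⟨s, hs, hsn⟩ := Set.not_subset.1 hnot
  have hcompact : IsCompact (F '' (M \ U)) :=
    (hK.of_isClosed_subset hcl (Set.sdiff_subset.trans hMK)).image hF
  refine ⟨s, hs, (F '' (M \ U))ᶜ, hcompact.isClosed.isOpen_compl,
    Set.eq_singleton_iff_unique_mem.2 ⟨⟨hsn, hs⟩, fun s' hs' => ?_⟩⟩
  rw [huniq s hs hsn, huniq s' hs'.2 hs'.1]

@[simp] theorem chi_eq_true {α : Type*} {A : Set α} {x : α} : chi A x = true ↔ x ∈ A := by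
  simp [chi]

theorem isClopen_setOf_apply_eq {α : Type*} (p : α) (b : Bool) :
    IsClopen {g : α → Bool | g p = b} :=
  (isClopen_discrete {b}).preimage (continuous_apply (A := fun _ : α => Bool) p)

theorem isClosed_range_chi_lowerSet {β : Type*} [LE β] :
    IsClosed (Set.range fun D : LowerSet β => chi (D : Set β)) := by
  have : (Set.range fun D : LowerSet β => chi (D : Set β)) =
      ⋂ (a : β) (b : β) (_ : a ≤ b), ({g | g b = false} ∪ {g | g a = true}) := by
    ext g
    simp only [Set.mem_range, Set.mem_iInter, Set.mem_union, Set.mem_ofPred_eq]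
    constructor
    · rintro ⟨D, rfl⟩ a b hab
      by_cases hb : b ∈ D
      · exact .inr (chi_eq_true.2 (D.lower hab hb))
      · exact .inl (by simpa [← Bool.not_eq_true] using hb)
    · intro hg
      refine ⟨⟨{x | g x = true}, fun b a hab hb => ?_⟩, funext fun x => ?_⟩
      · simpa [hb.out] using hg a b hab
      · rw [Bool.eq_iff_iff, chi_eq_true]; rfl
  rw [this]
  exact isClosed_iInter fun a => isClosed_iInter fun b => isClosed_iInter fun _ =>
    (isClopen_setOf_apply_eq _ _).1.union (isClopen_setOf_apply_eq _ _).1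

/-- The space of lower sets of a scattered chain is topologically scattered. -/
theorem topScattered_range_chi_lowerSet {β : Type*} [LinearOrder β] (h : IsEmpty (ℚ ↪o β)) :
    TopScattered (Set.range fun D : LowerSet β => chi (D : Set β)) := by
  intro S hS hne
  let L := {D : LowerSet β // chi (D : Set β) ∈ S}
  have : Nonempty L := by
    obtain ⟨g, hg⟩ := hne
    obtain ⟨D, rfl⟩ := hS hg
    exact ⟨D, hg⟩
  by_contra hiso
  have hQ : Nonempty (ℚ ↪o L) := by
    refine nonempty_rat_orderEmbedding fun y ⟨hlo, hhi⟩ => hiso ?_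
    have hlow : ∃ U : Set (β → Bool), IsOpen U ∧ chi (y.1 : Set β) ∈ U ∧
        ∀ D : L, chi (D.1 : Set β) ∈ U → y ≤ D := by
      rcases hlo with hmin | ⟨w, hw⟩
      · exact ⟨Set.univ, isOpen_univ, trivial, fun D _ => (le_total y D).elim id fun hD => hmin hD⟩
      · obtain ⟨p, hp, hpw⟩ := Set.not_subset.1 (not_le_of_gt hw.lt)
        refine ⟨{g | g p = true}, (isClopen_setOf_apply_eq p true).2, chi_eq_true.2 hp, fun D hD => ?_⟩
        refine hw.ge_of_gt (lt_of_not_ge fun hDw => hpw (hDw (chi_eq_true.1 hD)))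
    have hupp : ∃ U : Set (β → Bool), IsOpen U ∧ chi (y.1 : Set β) ∈ U ∧
        ∀ D : L, chi (D.1 : Set β) ∈ U → D ≤ y := by
      rcases hhi with hmax | ⟨z, hz⟩
      · exact ⟨Set.univ, isOpen_univ, trivial, fun D _ => (le_total D y).elim id fun hD => hmax hD⟩
      · obtain ⟨p, hp, hpy⟩ := Set.not_subset.1 (not_le_of_gt hz.lt)
        refine ⟨{g | g p = false}, (isClopen_setOf_apply_eq p false).2,
          Bool.eq_false_of_not_eq_true (mt chi_eq_true.1 hpy), fun D hD => ?_⟩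
        refine hz.le_of_lt (lt_of_not_ge fun hDz => ?_)
        have hpD : p ∈ (D.1 : Set β) := hDz hp
        rw [← chi_eq_true, hD.out] at hpD
        exact Bool.false_ne_true hpD
    obtain ⟨U, hU, hyU, hUy⟩ := hlow
    obtain ⟨V, hV, hyV, hVy⟩ := hupp
    refine ⟨_, y.2, U ∩ V, hU.inter hV, Set.eq_singleton_iff_unique_mem.2
      ⟨⟨⟨hyU, hyV⟩, y.2⟩, ?_⟩⟩
    rintro g ⟨⟨hgU, hgV⟩, hgS⟩
    obtain ⟨D, rfl⟩ := hS hgS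
    rw [le_antisymm (hUy ⟨D, hgS⟩ hgU) (hVy ⟨D, hgS⟩ hgV)]
  obtain ⟨f⟩ := hQ
  exact (isEmpty_rat_orderEmbedding_lowerSet h).elim (f.trans (OrderEmbedding.subtype _))

end Topology

section Lexicographic

/-- The lexicographic combination of a list of relations. -/
def lexRel {α : Type*} : List (α → α → Prop) → α → α → Prop
  | [] => fun _ _ => True
  | s :: l => fun a b => s a b ∧ (s b a → lexRel l a b)

variable {α : Type*} {l : List (α → α → Prop)}

theorem lexRel_of_forall {a b : α} (h : ∀ s ∈ l, s a b) : lexRel l a b := by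
  induction l with
  | nil => trivial
  | cons s l ih =>
    rw [List.forall_mem_cons] at h
    exact ⟨h.1, fun _ => ih h.2⟩

theorem lexRel_trans (hl : ∀ s ∈ l, IsTrans α s) {a b c : α} (hab : lexRel l a b)
    (hbc : lexRel l b c) : lexRel l a c := by
  induction l with
  | nil => trivial
  | cons s l ih =>
    rw [List.forall_mem_cons] at hl
    have := hl.1
    exact ⟨_root_.trans hab.1 hbc.1, fun hca =>
      ih hl.2 (hab.2 (_root_.trans hbc.1 hca)) (hbc.2 (_root_.trans hca hab.1))⟩

theorem lexRel_total (hl : ∀ s ∈ l, Std.Total s) (a b : α) : lexRel l a b ∨ lexRel l b a := by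
  induction l with
  | nil => exact .inl trivial
  | cons s l ih =>
    rw [List.forall_mem_cons] at hl
    have := hl.1.total a b
    have := ih hl.2
    simp only [lexRel]
    tauto

theorem forall_mem_of_lexRel_of_lexRel {a b : α} (hab : lexRel l a b) (hba : lexRel l b a) :
    ∀ s ∈ l, s a b := by
  induction l with
  | nil => simp
  | cons s l ih =>
    rw [List.forall_mem_cons]
    exact ⟨hab.1, ih (hab.2 hba.1) (hba.2 hab.1)⟩

/-- A lexicographic combination of finitely many scattered total preorders is scattered. -/
theorem noRatEmbedRel_lexRel (ht : ∀ s ∈ l, IsTrans α s) (hl : ∀ s ∈ l, NoRatEmbedRel s) :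
    NoRatEmbedRel (lexRel l) := by
  induction l with
  | nil =>
    rintro ⟨f, hf⟩
    exact absurd ((hf 1 0).2 trivial) (by norm_num)
  | cons s l ih =>
    rw [List.forall_mem_cons] at hl ht
    have := ht.1
    rintro ⟨f, hf⟩
    by_cases hs : ∀ q q', q < q' → ¬ s (f q') (f q)
    · refine hl.1 ⟨f, fun q q' => ⟨fun h => ((hf q q').1 h).1, fun h => ?_⟩⟩
      by_contra! hlt
      exact hs _ _ hlt h
    · push Not at hs
      obtain ⟨a, b, hab, hsab⟩ := hs
      have mono {q q' : ℚ} (h : q ≤ q') : s (f q) (f q') := ((hf q q').1 h).1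
      have : Nontrivial (Set.Ioo a b) := by
        obtain ⟨c, hac, hcb⟩ := exists_between hab
        obtain ⟨d, hcd, hdb⟩ := exists_between hcb
        exact ⟨⟨c, hac, hcb⟩, ⟨d, hac.trans hcd, hdb⟩, fun h => hcd.ne (congrArg Subtype.val h)⟩
      obtain ⟨g⟩ := Order.embedding_from_countable_to_dense (α := ℚ) (β := Set.Ioo a b)
      have hsg (q q' : ℚ) : s (f (g q)) (f (g q')) :=
        _root_.trans (mono (g q).2.2.le) (_root_.trans hsab (mono (g q').2.1.le))
      refine ih ht.2 hl.2 ⟨fun q => f (g q), fun q q' => ?_⟩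
      rw [← g.le_iff_le, ← Subtype.coe_le_coe, hf]
      exact ⟨fun h => h.2 (hsg _ _), fun h => ⟨hsg _ _, fun _ => h⟩⟩

end Lexicographic

section MacNeille

/-- The bundled linear order given by a relation. -/
noncomputable abbrev linearOrderOfRel {α : Type*} (r : α → α → Prop) (h : IsLinearOrder α r) :
    LinearOrder α where
  le := r
  le_refl := h.refl
  le_trans := h.trans
  le_antisymm := h.antisymm
  le_total := h.total
  toDecidableLE := Classical.decRel _

theorem Iic_mem_macNeille {α : Type*} [PartialOrder α] (a : α) : Set.Iic a ∈ MacNeille α :=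
  ⟨{a}, by simp [Set.Iic]⟩

/-- The lower set of a linear order `r` generated by a set. -/
def relLowerClosure {α : Type*} (r : α → α → Prop) (h : IsLinearOrder α r) (A : Set α) :
    @LowerSet α ⟨r⟩ :=
  @LowerSet.mk α ⟨r⟩ {x | ∃ a ∈ A, r x a} fun _ _ hyx ⟨a, ha, hxa⟩ =>
    ⟨a, ha, h.trans _ _ _ hyx hxa⟩

variable {α : Type*} [PartialOrder α] {ι : Type*} {r : ι → α → α → Prop}

theorem mem_of_forall_exists_rel (hr : ∀ i, IsLinearOrder α (r i))
    (hle : ∀ a b : α, a ≤ b ↔ ∀ i, r i a b) {B : Set α} (hB : B ∈ MacNeille α) {a : α}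
    (ha : ∀ i, ∃ b ∈ B, r i a b) : a ∈ B := by
  obtain ⟨X, rfl⟩ := hB
  refine Set.mem_iInter₂.2 fun x hx => (hle a x).2 fun i => ?_
  obtain ⟨b, hb, hab⟩ := ha i
  exact (hr i).trans _ _ _ hab ((hle b x).1 (Set.mem_iInter₂.1 hb x hx) i)

theorem exists_embedding_of_inter {α : Type u} [PartialOrder α] {ι : Type*}
    {r : ι → α → α → Prop} (hr : ∀ i, IsLinearOrder α (r i)) (hQ : ∀ i, NoRatEmbedRel (r i))
    (hle : ∀ a b : α, a ≤ b ↔ ∀ i, r i a b) :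
    ∃ (C : ι → Type u) (inst : ∀ i, LinearOrder (C i)) (Φ : Set α → ∀ i, C i),
      (∀ i, NoRatEmbedRel fun x y : C i => (inst i).le x y) ∧
      (∀ A ∈ MacNeille α, ∀ B ∈ MacNeille α,
        (A ⊆ B ↔ ∀ i, (inst i).le (Φ A i) (Φ B i))) := by
  refine ⟨fun i => @LowerSet α ⟨r i⟩,
    fun i => @LowerSet.instLinearOrder α (linearOrderOfRel (r i) (hr i)),
    fun A i => relLowerClosure (r i) (hr i) A, fun i => ?_, fun A hA B hB => ⟨?_, ?_⟩⟩
  · let := linearOrderOfRel (r i) (hr i)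
    exact noRatEmbedRel_le_iff.2
      (isEmpty_rat_orderEmbedding_lowerSet (noRatEmbedRel_le_iff.1 (hQ i)))
  · rintro hAB i x ⟨a, ha, hxa⟩
    exact ⟨a, hAB ha, hxa⟩
  · intro h a ha
    exact mem_of_forall_exists_rel hr hle hB fun i => h i ⟨a, ha, (hr i).refl a⟩

theorem exists_inter_of_embedding {n : ℕ} {C : Fin n → Type*} (inst : ∀ i, LinearOrder (C i))
    (Φ : Set α → ∀ i, C i) (hQ : ∀ i, NoRatEmbedRel fun x y : C i => (inst i).le x y)
    (hΦ : ∀ A ∈ MacNeille α, ∀ B ∈ MacNeille α,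
      (A ⊆ B ↔ ∀ i, (inst i).le (Φ A i) (Φ B i))) :
    ∃ r : Fin n → α → α → Prop, (∀ i, IsLinearOrder α (r i)) ∧ (∀ i, NoRatEmbedRel (r i)) ∧
      (∀ a b : α, a ≤ b ↔ ∀ i, r i a b) := by
  let s (i : Fin n) (a b : α) : Prop := (inst i).le (Φ (Set.Iic a) i) (Φ (Set.Iic b) i)
  have hle (a b : α) : a ≤ b ↔ ∀ i, s i a b := by
    rw [← Set.Iic_subset_Iic]
    exact hΦ _ (Iic_mem_macNeille a) _ (Iic_mem_macNeille b)
  have hmem {p : (α → α → Prop) → Prop} (h : ∀ i, p (s i)) (i : Fin n) :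
      ∀ t ∈ s i :: List.ofFn s, p t := by
    simp only [List.mem_cons, List.mem_ofFn]
    rintro t (rfl | ⟨j, rfl⟩) <;> exact h _
  have htrans := hmem (p := IsTrans α) fun i =>
    ⟨fun a b c hab hbc => (inst i).le_trans _ _ _ hab hbc⟩
  have htotal := hmem (p := Std.Total) fun i => ⟨fun a b => (inst i).le_total _ _⟩
  have hscat := hmem (p := NoRatEmbedRel) fun i ⟨f, hf⟩ =>
    hQ i ⟨fun q => Φ (Set.Iic (f q)) i, hf⟩
  have hanti (i : Fin n) {a b : α} (hab : lexRel (s i :: List.ofFn s) a b)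
      (hba : lexRel (s i :: List.ofFn s) b a) : a ≤ b :=
    (hle a b).2 fun j => forall_mem_of_lexRel_of_lexRel hab hba _
      (List.mem_cons_of_mem _ (List.mem_ofFn.2 ⟨j, rfl⟩))
  refine ⟨fun i => lexRel (s i :: List.ofFn s), fun i => ?_,
    fun i => noRatEmbedRel_lexRel (htrans i) (hscat i), fun a b => ⟨fun hab i => ?_, fun h => ?_⟩⟩
  · exact
      { refl := fun a => (or_self_iff.1 (lexRel_total (htotal i) a a))
        trans := fun a b c => lexRel_trans (htrans i)
        antisymm := fun a b hab hba => le_antisymm (hanti i hab hba) (hanti i hba hab)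
        total := lexRel_total (htotal i) }
  · exact lexRel_of_forall (hmem ((hle a b).1 hab) i)
  · exact (hle a b).2 fun i => (h i).1

theorem topScattered_closure_macNeille [Finite ι] (hr : ∀ i, IsLinearOrder α (r i))
    (hQ : ∀ i, NoRatEmbedRel (r i)) (hle : ∀ a b : α, a ≤ b ↔ ∀ i, r i a b) :
    TopScattered (closure (chi '' MacNeille α)) := by
  let K (i : ι) : Set (α → Bool) :=
    Set.range fun D : @LowerSet α ⟨r i⟩ => chi (@SetLike.coe _ _ (@LowerSet.instSetLike α ⟨r i⟩) D)
  have hKscat (i : ι) : TopScattered (K i) := by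
    let := linearOrderOfRel (r i) (hr i)
    exact topScattered_range_chi_lowerSet (noRatEmbedRel_le_iff.1 (hQ i))
  have hKcompact (i : ι) : IsCompact (K i) :=
    (@isClosed_range_chi_lowerSet α ⟨r i⟩).isCompact
  let F (D : ι → α → Bool) : α → Bool := fun x => @decide (∀ i, D i x = true) (Classical.dec _)
  have hF : Continuous F := continuous_pi fun x =>
    (continuous_of_discreteTopology
      (f := fun v : ι → Bool => @decide (∀ i, v i = true) (Classical.dec _))).comp
      (continuous_pi fun i => (continuous_apply x).comp (continuous_apply i))
  have hcompact : IsCompact (Set.univ.pi K) := isCompact_univ_pi hKcompact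
  refine ((TopScattered.pi hKscat).image hcompact hF).mono
    (closure_minimal ?_ (hcompact.image hF).isClosed)
  rintro _ ⟨A, hA, rfl⟩
  refine ⟨fun i => chi {x | ∃ a ∈ A, r i x a},
    fun i _ => ⟨relLowerClosure (r i) (hr i) A, rfl⟩, funext fun x => ?_⟩
  rw [Bool.eq_iff_iff, chi_eq_true]
  simp only [F, decide_eq_true_eq, chi_eq_true, Set.mem_ofPred_eq]
  exact ⟨mem_of_forall_exists_rel hr hle hA, fun hx i => ⟨x, hx, (hr i).refl x⟩⟩

end MacNeille

/-- For a poset `P` and `n ≥ 1`, the order of `P` is the intersection of `n` scattered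
linear orders if and only if the MacNeille completion `N(P)` order-embeds into a product
of `n` scattered chains; moreover, in that case the topological closure of `N(P)` in the
Cantor space of subsets of `P` is topologically scattered. -/
theorem macNeille_embeds_product_scattered_chains_iff
    {α : Type u} [PartialOrder α] (n : ℕ) (hn : 0 < n) :
    ((∃ r : Fin n → α → α → Prop,
        (∀ i, IsLinearOrder α (r i)) ∧
        (∀ i, NoRatEmbedRel (r i)) ∧
        (∀ a b : α, a ≤ b ↔ ∀ i, r i a b)) ↔
      (∃ (C : Fin n → Type u) (inst : ∀ i, LinearOrder (C i))
          (Φ : Set α → ∀ i, C i),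
        (∀ i, NoRatEmbedRel fun x y : C i => (inst i).le x y) ∧
        (∀ A ∈ MacNeille α, ∀ B ∈ MacNeille α,
          (A ⊆ B ↔ ∀ i, (inst i).le (Φ A i) (Φ B i))))) ∧
    ((∃ r : Fin n → α → α → Prop,
        (∀ i, IsLinearOrder α (r i)) ∧
        (∀ i, NoRatEmbedRel (r i)) ∧
        (∀ a b : α, a ≤ b ↔ ∀ i, r i a b)) →
      TopScattered (closure (chi '' MacNeille α))) := by
  refine ⟨⟨?_, ?_⟩, ?_⟩
  · rintro ⟨r, hr, hQ, hle⟩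
    exact exists_embedding_of_inter hr hQ hle
  · rintro ⟨C, inst, Φ, hQ, hΦ⟩
    exact exists_inter_of_embedding inst Φ hQ hΦ
  · rintro ⟨r, hr, hQ, hle⟩
    exact topScattered_closure_macNeille hr hQ hle
end

section
/- Let P be a poset. The following are equivalent: (i) there exist two linear orders r 1, r 2 on the underlying set of P, neither admitting an order embedding of ℚ, such that a ≤ b ↔ (r 1 a b and r 2 a b); (ii) (a) there exists a linear order L on P extending ≤ (a ≤ b → L a b), not admitting an order embedding of ℚ, and non-separating, i.e., there are no x, y, z with x < z in P, y incomparable in P to both x and z, and L x y, L y z with y ≠ x, y ≠ z; and (b) for every injective map e : ℚ → ℕ there is no map f : ℚ → P with f q ≤ f q' ↔ (q ≤ q' and e q ≤ e q'), and no map g : ℚ → P with g q ≤ g q' ↔ (q' ≤ q and e q' ≤ e q) (neither Ω(η) nor its dual embeds in P). -/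
/-- A linear extension `L` of a poset is non-separating when there are no `x, y, z` with
`x < z`, `y` incomparable to both `x` and `z`, and `x <_L y <_L z`. -/
def NonSeparating {α : Type*} [PartialOrder α] (L : α → α → Prop) : Prop :=
  ¬ ∃ x y z : α, x < z ∧
      (¬ y ≤ x ∧ ¬ x ≤ y) ∧ (¬ y ≤ z ∧ ¬ z ≤ y) ∧
      L x y ∧ L y z ∧ y ≠ x ∧ y ≠ z

open Set

/-- A set of rationals contains a copy of `ℚ`, i.e. it is not scattered. -/
def ContainsRat (S : Set ℚ) : Prop := ∃ h : ℚ ↪o ℚ, ∀ q, h q ∈ S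

/-- The closed interval between `x` and `y` for the relation `r`. -/
def RelIcc {β : Type*} (r : β → β → Prop) (x y : β) : Set β := {z | r x z ∧ r z y}

theorem ContainsRat.mono {S T : Set ℚ} (h : ContainsRat S) (hST : S ⊆ T) : ContainsRat T :=
  h.imp fun _ hf q ↦ hST (hf q)

theorem not_containsRat_singleton (x : ℚ) : ¬ ContainsRat {x} := by
  rintro ⟨h, hh⟩
  have h01 : h 0 = h 1 := (hh 0).trans (hh 1).symm
  exact absurd (h.injective h01) (by norm_num)

theorem containsRat_Ioo {a b : ℚ} (hab : a < b) : ContainsRat (Ioo a b) := by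
  have : Nontrivial (Ioo a b) := (nontrivial_coe_sort.2 (Ioo_infinite hab).nontrivial)
  obtain ⟨h⟩ := Order.embedding_from_countable_to_dense ℚ (Ioo a b)
  exact ⟨h.trans (OrderEmbedding.subtype _), fun q ↦ (h q).2⟩

theorem ContainsRat.image {S : Set ℚ} (hS : ContainsRat S) (g : ℚ ↪o ℚ) :
    ContainsRat (g '' S) := by
  obtain ⟨h, hh⟩ := hS
  exact ⟨h.trans g, fun q ↦ ⟨h q, hh q, rfl⟩⟩

theorem containsRat_of_dense {S : Set ℚ}
    (hS : ∀ a b : ℚ, a < b → ∃ y ∈ S, a < y ∧ y < b) : ContainsRat S := by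
  have : DenselyOrdered S := ⟨fun x y hxy ↦ by
    obtain ⟨z, hz, h1, h2⟩ := hS x y hxy
    exact ⟨⟨z, hz⟩, h1, h2⟩⟩
  have : Nontrivial S := by
    obtain ⟨x, hx, h1, h2⟩ := hS 0 1 (by norm_num)
    obtain ⟨y, hy, h3, h4⟩ := hS 1 2 (by norm_num)
    exact ⟨⟨x, hx⟩, ⟨y, hy⟩, fun h ↦ by
      have : x = y := congrArg Subtype.val h
      linarith⟩
  obtain ⟨h⟩ := Order.embedding_from_countable_to_dense ℚ S
  exact ⟨h.trans (OrderEmbedding.subtype _), fun q ↦ (h q).2⟩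

/-- The order type of `ℚ` is indivisible. -/
theorem ContainsRat.of_union {S T : Set ℚ} (h : ContainsRat (S ∪ T)) :
    ContainsRat S ∨ ContainsRat T := by
  obtain ⟨h, hh⟩ := h
  by_cases hd : ∀ a b : ℚ, a < b → ∃ y ∈ h ⁻¹' S, a < y ∧ y < b
  · exact .inl (((containsRat_of_dense hd).image h).mono (image_preimage_subset _ _))
  · push Not at hd
    obtain ⟨a, b, hab, hd⟩ := hd
    refine .inr (((containsRat_Ioo hab).image h).mono ?_)
    rintro _ ⟨y, hy, rfl⟩
    exact (hh y).resolve_left fun hyS ↦ absurd hy.2 (not_lt.2 (hd y hyS hy.1))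

/-- A dense strict weak order in which some two elements are related contains a copy of `ℚ`. -/
theorem exists_rat_map_of_dense {β : Type*} (s : β → β → Prop) (hirr : ∀ x, ¬ s x x)
    (htrans : ∀ x y z, s x y → s y z → s x z)
    (hneg : ∀ x y z, s x z → s x y ∨ s y z) (hdense : ∀ x y, s x y → ∃ z, s x z ∧ s z y)
    (hne : ∃ x y, s x y) : ∃ f : ℚ → β, ∀ q q', q < q' → s (f q) (f q') := by
  classical
  let _ : Preorder β :=
    { le := fun a b ↦ ¬ s b a
      lt := s
      le_refl := hirr
      le_trans := fun a b c hab hbc hca ↦ (hneg c b a hca).elim hbc hab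
      lt_iff_le_not_ge := fun a b ↦
        ⟨fun h ↦ ⟨fun h' ↦ hirr _ (htrans _ _ _ h h'), not_not_intro h⟩, fun h ↦ not_not.1 h.2⟩ }
  have : @Std.Total β (· ≤ ·) := ⟨fun a b ↦ by
    by_contra! h
    exact hirr _ (htrans _ _ _ (not_not.1 h.1) (not_not.1 h.2))⟩
  have : DenselyOrdered (Antisymmetrization β (· ≤ ·)) := ⟨fun x y hxy ↦ by
    obtain ⟨z, h1, h2⟩ := hdense _ _ (ofAntisymmetrization_lt_ofAntisymmetrization_iff.2 hxy)
    refine ⟨toAntisymmetrization _ z, ?_, ?_⟩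
    · rw [← toAntisymmetrization_ofAntisymmetrization (· ≤ ·) x]
      exact toAntisymmetrization_lt_toAntisymmetrization_iff.2 h1
    · rw [← toAntisymmetrization_ofAntisymmetrization (· ≤ ·) y]
      exact toAntisymmetrization_lt_toAntisymmetrization_iff.2 h2⟩
  have : Nontrivial (Antisymmetrization β (· ≤ ·)) := by
    obtain ⟨x, y, hxy⟩ := hne
    have hxy' : x < y := hxy
    exact ⟨_, _, (toAntisymmetrization_lt_toAntisymmetrization_iff.2 hxy').ne⟩
  obtain ⟨h⟩ := Order.embedding_from_countable_to_dense ℚ (Antisymmetrization β (· ≤ ·))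
  exact ⟨fun q ↦ ofAntisymmetrization _ (h q), fun q q' hq ↦
    ofAntisymmetrization_lt_ofAntisymmetrization_iff.2 (h.strictMono hq)⟩

theorem isLinearOrder_swap {β : Type*} {r : β → β → Prop} (hr : IsLinearOrder β r) :
    IsLinearOrder β (Function.swap r) :=
  { refl := hr.refl
    trans := fun a b c hab hbc ↦ hr.trans c b a hbc hab
    antisymm := fun a b hab hba ↦ hr.antisymm a b hba hab
    total := fun a b ↦ hr.total b a }

theorem isLinearOrder_comap {α β : Type*} {r : β → β → Prop} (hr : IsLinearOrder β r)
    {f : α → β} (hf : Function.Injective f) : IsLinearOrder α (fun a b ↦ r (f a) (f b)) :=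
  { refl := fun _ ↦ hr.refl _
    trans := fun _ _ _ hab hbc ↦ hr.trans _ _ _ hab hbc
    antisymm := fun _ _ hab hba ↦ hf (hr.antisymm _ _ hab hba)
    total := fun _ _ ↦ hr.total _ _ }

/-- For a scattered linear order `r` on `ℚ`, some initial or final segment of `r` contains a copy
of `ℚ` although its bounded intervals do not. -/
theorem exists_containsRat_of_noRatEmbedRel {r : ℚ → ℚ → Prop} (hr : IsLinearOrder ℚ r)
    (hs : NoRatEmbedRel r) :
    ∃ x, ContainsRat {z | r x z ∧ ¬ ContainsRat (RelIcc r x z)} ∨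
      ContainsRat {z | r z x ∧ ¬ ContainsRat (RelIcc r z x)} := by
  by_contra! H
  have hself : ∀ x, ¬ ContainsRat (RelIcc r x x) := fun x h ↦
    not_containsRat_singleton x (h.mono fun z hz ↦ hr.antisymm _ _ hz.2 hz.1)
  have hle : ∀ x y, ContainsRat (RelIcc r x y) → r x y := fun x y ⟨h, hh⟩ ↦
    hr.trans _ _ _ (hh 0).1 (hh 0).2
  obtain ⟨f, hf⟩ := exists_rat_map_of_dense (fun x y ↦ ContainsRat (RelIcc r x y)) hself
    (fun x y z hxy hyz ↦ hxy.mono fun w hw ↦ ⟨hw.1, hr.trans _ _ _ hw.2 (hle _ _ hyz)⟩)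
    (fun x y z hxz ↦ by
      refine (hxz.mono ?_ : ContainsRat (RelIcc r x y ∪ RelIcc r y z)).of_union
      intro w hw
      exact (hr.total w y).imp (fun h ↦ ⟨hw.1, h⟩) (fun h ↦ ⟨h, hw.2⟩))
    (fun x y hxy ↦ by
      by_contra! hd
      refine ((hxy.mono ?_ : ContainsRat (_ ∪ _)).of_union).elim (H x).1 (H y).2
      intro w hw
      by_cases hxw : ContainsRat (RelIcc r x w)
      · exact .inr ⟨hw.2, hd w hxw⟩
      · exact .inl ⟨hw.1, hxw⟩)
    (by
      by_contra! hd
      have huniv : ContainsRat univ := ⟨RelEmbedding.refl _, fun _ ↦ mem_univ _⟩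
      refine ((huniv.mono ?_ : ContainsRat (_ ∪ _)).of_union).elim (H 0).1 (H 0).2
      intro w _
      exact (hr.total 0 w).imp (fun h ↦ ⟨h, hd _ _⟩) (fun h ↦ ⟨h, hd _ _⟩))
  refine hs ⟨f, fun q q' ↦ ⟨fun h ↦ ?_, fun h ↦ ?_⟩⟩
  · rcases h.eq_or_lt with rfl | h
    · exact hr.refl _
    · exact hle _ _ (hf _ _ h)
  · by_contra! hlt
    have h1 := hf _ _ hlt
    rw [hr.antisymm _ _ h (hle _ _ h1)] at h1
    exact hself _ h1

/-- If a final segment of `r` contains a copy of `ℚ` although its bounded intervals do not, then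
some copy of `ℚ` is ordered by `r` in type `ω`. -/
theorem exists_rat_map_of_containsRat {r : ℚ → ℚ → Prop} (hr : IsLinearOrder ℚ r) {x : ℚ}
    (hx : ContainsRat {z | r x z ∧ ¬ ContainsRat (RelIcc r x z)}) :
    ∃ (ψ : ℚ ↪o ℚ) (e : ℚ → ℕ), Function.Injective e ∧
      ∀ q q', r (ψ q) (ψ q') ↔ e q ≤ e q' := by
  obtain ⟨φ, hφ⟩ := hx
  have key : ∀ (p : ℚ) (I : {I : ℚ × ℚ // I.1 < I.2}),
      ∃ y, (I.1.1 < y ∧ y < I.1.2) ∧ ¬ r (φ y) (φ p) := by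
    intro p I
    by_contra! hd
    refine (hφ p).2 (((containsRat_Ioo I.2).image φ).mono ?_)
    rintro _ ⟨y, hy, rfl⟩
    exact ⟨(hφ y).1, hd y hy⟩
  choose next hnext hlt using key
  have : Nonempty {I : ℚ × ℚ // I.1 < I.2} := ⟨⟨(0, 1), by norm_num⟩⟩
  obtain ⟨I, hI⟩ := exists_surjective_nat {I : ℚ × ℚ // I.1 < I.2}
  let u : ℕ → ℚ := fun n ↦ Nat.rec (next 0 (I 0)) (fun n p ↦ next p (I (n + 1))) n
  have hu : ∀ n, (I n).1.1 < u n ∧ u n < (I n).1.2 := by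
    rintro (_ | n) <;> exact hnext _ _
  have hle : ∀ m n, m ≤ n → r (φ (u m)) (φ (u n)) := by
    intro m n hmn
    induction hmn with
    | refl => exact hr.refl _
    | step _ ih => exact hr.trans _ _ _ ih ((hr.total _ _).resolve_right (hlt _ _))
  have hiff : ∀ m n, r (φ (u m)) (φ (u n)) ↔ m ≤ n := by
    refine fun m n ↦ ⟨fun h ↦ ?_, hle m n⟩
    by_contra! hnm
    exact hlt (u n) (I (n + 1)) (hr.trans _ _ _ (hle (n + 1) m hnm) h)
  obtain ⟨h, hh⟩ := containsRat_of_dense (S := range u) fun a b hab ↦ by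
    obtain ⟨n, hn⟩ := hI ⟨(a, b), hab⟩
    have := hu n
    rw [hn] at this
    exact ⟨u n, mem_range_self n, this⟩
  choose e he using hh
  refine ⟨h.trans φ, e, fun q q' hq ↦ h.injective ?_, fun q q' ↦ ?_⟩
  · rw [← he, ← he, hq]
  · simp [← he, hiff]

/-- Any two linear orders realizing `Ω(η)` are `≤` and the order induced by `e`: one of them
is the usual order of `ℚ`. -/
theorem eq_le_of_inter_eq {r₁ r₂ : ℚ → ℚ → Prop} (h₁ : IsLinearOrder ℚ r₁)
    (h₂ : IsLinearOrder ℚ r₂) {e : ℚ → ℕ} (he : Function.Injective e)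
    (H : ∀ q q', (r₁ q q' ∧ r₂ q q') ↔ (q ≤ q' ∧ e q ≤ e q')) :
    (∀ q q', q ≤ q' ↔ r₁ q q') ∨ (∀ q q', q ≤ q' ↔ r₂ q q') := by
  have hex : ∀ (N : ℕ) (a b : ℚ), a < b → ∃ c, a < c ∧ c < b ∧ N < e c := by
    intro N a b hab
    have hfin : (e ⁻¹' Iic N).Finite := (finite_Iic N).preimage he.injOn
    obtain ⟨c, hc, hcN⟩ := ((Ioo_infinite hab).sdiff hfin).nonempty
    exact ⟨c, hc.1, hc.2, not_le.1 hcN⟩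
  have hor : ∀ c b, c < b → r₁ c b ∨ r₂ c b := by
    intro c b hcb
    by_contra! h
    have := (H b c).1 ⟨(h₁.total _ _).resolve_left h.1, (h₂.total _ _).resolve_left h.2⟩
    exact absurd this.1 (not_le.2 hcb)
  have hnot : ∀ c b, e b < e c → r₁ c b → ¬ r₂ c b := fun c b h h1 h2 ↦
    absurd ((H c b).1 ⟨h1, h2⟩).2 (not_le.2 h)
  have left : ∀ b c d, c < d → d < b → e b < e c → e c < e d → (r₁ c b ↔ r₁ d b) := by
    intro b c d hcd hdb hbc hced
    obtain ⟨k1, k2⟩ := (H c d).2 ⟨hcd.le, hced.le⟩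
    refine ⟨fun h ↦ (hor d b hdb).resolve_right fun h' ↦ ?_, fun h ↦ h₁.trans _ _ _ k1 h⟩
    exact hnot c b hbc h (h₂.trans _ _ _ k2 h')
  have right : ∀ b b' c, b < b' → e b < e b' → c < b → e b' < e c → (r₁ c b ↔ r₁ c b') := by
    intro b b' c hbb hebb hcb hec
    obtain ⟨k1, k2⟩ := (H b b').2 ⟨hbb.le, hebb.le⟩
    refine ⟨fun h ↦ h₁.trans _ _ _ h k1, fun h ↦ (hor c b hcb).resolve_right fun h' ↦ ?_⟩
    exact hnot c b' hec h (h₂.trans _ _ _ h' k2)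
  have left' : ∀ b c c', c < b → c' < b → e b < e c → e b < e c' → (r₁ c b ↔ r₁ c' b) := by
    intro b c c' hc hc' hec hec'
    obtain ⟨d, hd, hdb, hed⟩ := hex (max (e c) (e c')) (max c c') b (max_lt hc hc')
    rw [max_lt_iff] at hd hed
    rw [left b c d hd.1 hdb hec hed.1, left b c' d hd.2 hdb hec' hed.2]
  have all : ∀ c b c' b', c < b → c' < b' → e b < e c → e b' < e c' →
      (r₁ c b ↔ r₁ c' b') := by
    intro c b c' b' hc hc' hec hec'
    obtain ⟨b'', hb, -, heb⟩ := hex (max (e b) (e b')) (max b b') (max b b' + 1) (lt_add_one _)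
    obtain ⟨d, -, hd, hed⟩ := hex (e b'') (min b b' - 1) (min b b') (sub_one_lt _)
    rw [max_lt_iff] at hb heb
    rw [lt_min_iff] at hd
    rw [left' b c d hc hd.1 hec (heb.1.trans hed), right b b'' d hb.1 heb.1 hd.1 hed,
      left' b' c' d hc' hd.2 hec' (heb.2.trans hed), right b' b'' d hb.2 heb.2 hd.2 hed]
  have finish : ∀ {r : ℚ → ℚ → Prop}, IsLinearOrder ℚ r →
      (∀ q q', q ≤ q' → e q ≤ e q' → r q q') → (∀ c b, c < b → e b < e c → r c b) →
      ∀ q q', q ≤ q' ↔ r q q' := by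
    intro r hr hP hE
    have hlt : ∀ q q', q < q' → r q q' := fun q q' h ↦
      (le_or_gt (e q) (e q')).elim (hP q q' h.le) (hE q q' h)
    refine fun q q' ↦ ⟨fun h ↦ h.eq_or_lt.elim (fun h ↦ h ▸ hr.refl _) (hlt q q'), fun h ↦ ?_⟩
    by_contra! hn
    exact hn.ne (hr.antisymm _ _ (hlt _ _ hn) h)
  by_cases hc : ∀ c b, c < b → e b < e c → r₁ c b
  · exact .inl (finish h₁ (fun q q' h h' ↦ ((H q q').2 ⟨h, h'⟩).1) hc)
  · push Not at hc
    obtain ⟨c, b, hcb, heb, hn⟩ := hc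
    refine .inr (finish h₂ (fun q q' h h' ↦ ((H q q').2 ⟨h, h'⟩).2) fun c' b' hcb' heb' ↦ ?_)
    exact (hor c' b' hcb').resolve_left fun h ↦ hn ((all _ _ _ _ hcb hcb' heb heb').2 h)

/-- `Ω(η)` does not embed in the intersection of two scattered linear orders. -/
theorem not_exists_rat_map_of_noRatEmbedRel {α : Type*} {r₁ r₂ : α → α → Prop}
    (h₁ : IsLinearOrder α r₁) (h₂ : IsLinearOrder α r₂) (s₁ : NoRatEmbedRel r₁)
    (s₂ : NoRatEmbedRel r₂) {e : ℚ → ℕ} (he : Function.Injective e) :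
    ¬ ∃ f : ℚ → α, ∀ q q', (r₁ (f q) (f q') ∧ r₂ (f q) (f q')) ↔ (q ≤ q' ∧ e q ≤ e q') := by
  rintro ⟨f, hf⟩
  have hinj : Function.Injective f := by
    intro q q' hq
    refine le_antisymm ((hf q q').1 ?_).1 ((hf q' q).1 ?_).1 <;> rw [hq] <;>
      exact ⟨h₁.refl _, h₂.refl _⟩
  exact (eq_le_of_inter_eq (isLinearOrder_comap h₁ hinj) (isLinearOrder_comap h₂ hinj) he hf).elim
    (fun h ↦ s₁ ⟨f, h⟩) (fun h ↦ s₂ ⟨f, h⟩)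

theorem NoRatEmbedRel.swap {α : Type*} {r : α → α → Prop} (h : NoRatEmbedRel r) :
    NoRatEmbedRel (Function.swap r) := by
  rintro ⟨f, hf⟩
  refine h ⟨fun q ↦ f (-q), fun q q' ↦ ?_⟩
  rw [← neg_le_neg_iff, hf]

theorem nonSeparating_of_inter {α : Type*} [PartialOrder α] {r₁ r₂ : α → α → Prop}
    (h₂ : IsLinearOrder α r₂)
    (H : ∀ a b : α, a ≤ b ↔ (r₁ a b ∧ r₂ a b)) : NonSeparating r₁ := by
  rintro ⟨x, y, z, hxz, hyx, hyz, h1, h2, -, -⟩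
  have k1 : r₂ y x := (h₂.total _ _).resolve_right fun h ↦ hyx.2 ((H _ _).2 ⟨h1, h⟩)
  have k2 : r₂ z y := (h₂.total _ _).resolve_right fun h ↦ hyz.1 ((H _ _).2 ⟨h2, h⟩)
  have k3 : r₂ x z := ((H _ _).1 hxz.le).2
  exact hxz.ne (h₂.antisymm _ _ k3 (h₂.trans _ _ _ k2 k1))

/-- The conjugate of `L`: it keeps the comparabilities of the poset and reverses `L` on
incomparable pairs. -/
def ConjRel {α : Type*} [PartialOrder α] (L : α → α → Prop) (a b : α) : Prop :=
  a ≤ b ∨ (¬ a ≤ b ∧ ¬ b ≤ a ∧ L b a)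

theorem isLinearOrder_conjRel {α : Type*} [PartialOrder α] {L : α → α → Prop}
    (hL : IsLinearOrder α L) (hsep : NonSeparating L) : IsLinearOrder α (ConjRel L) where
  refl a := .inl le_rfl
  antisymm := by
    rintro a b (h | h) (h' | h')
    · exact le_antisymm h h'
    · exact absurd h h'.2.1
    · exact absurd h' h.2.1
    · exact hL.antisymm _ _ h'.2.2 h.2.2
  total a b := by
    by_cases hab : a ≤ b
    · exact .inl (.inl hab)
    by_cases hba : b ≤ a
    · exact .inr (.inl hba)
    exact (hL.total b a).imp (fun h ↦ .inr ⟨hab, hba, h⟩) (fun h ↦ .inr ⟨hba, hab, h⟩)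
  trans := by
    have key : ∀ x y z : α, x ≤ z → ¬ y ≤ x → ¬ x ≤ y → ¬ y ≤ z → ¬ z ≤ y → L x y → ¬ L y z := by
      intro x y z hxz h1 h2 h3 h4 h5 h6
      rcases hxz.eq_or_lt with rfl | hxz
      · exact h1 (hL.antisymm _ _ h6 h5).le
      · exact hsep ⟨x, y, z, hxz, ⟨h1, h2⟩, ⟨h3, h4⟩, h5, h6, fun h ↦ h1 h.le, fun h ↦ h3 h.le⟩
    rintro a b c (hab | ⟨hab, hba, lba⟩) (hbc | ⟨hbc, hcb, lcb⟩)
    · exact .inl (hab.trans hbc)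
    · by_cases hac : a ≤ c
      · exact .inl hac
      have hca : ¬ c ≤ a := fun h ↦ hcb (h.trans hab)
      exact .inr ⟨hac, hca, (hL.total _ _).resolve_right fun h ↦
        key a c b hab hca hac hcb hbc h lcb⟩
    · by_cases hac : a ≤ c
      · exact .inl hac
      have hca : ¬ c ≤ a := fun h ↦ hba (hbc.trans h)
      exact .inr ⟨hac, hca, (hL.total _ _).resolve_right fun h ↦
        key b a c hbc hab hba hac hca lba h⟩
    · by_cases hac : a ≤ c
      · exact .inl hac
      exact .inr ⟨hac, fun hca ↦ key c b a hca hbc hcb hba hab lcb lba, hL.trans _ _ _ lcb lba⟩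

theorem le_iff_rel_and_conjRel {α : Type*} [PartialOrder α] {L : α → α → Prop}
    (hL : IsLinearOrder α L) (hext : ∀ a b : α, a ≤ b → L a b) (a b : α) :
    a ≤ b ↔ (L a b ∧ ConjRel L a b) := by
  refine ⟨fun h ↦ ⟨hext _ _ h, .inl h⟩, ?_⟩
  rintro ⟨h, h' | h'⟩
  · exact h'
  · exact (hL.antisymm _ _ h h'.2.2).le

/-- The order of a poset `P` is the intersection of two scattered linear orders if and
only if `P` has a scattered non-separating linear extension and neither `Ω(η)` nor its
dual embeds into `P`. -/
theorem inter_two_scattered_linear_orders_iff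
    {α : Type*} [PartialOrder α] :
    (∃ r₁ r₂ : α → α → Prop,
        IsLinearOrder α r₁ ∧ IsLinearOrder α r₂ ∧
        NoRatEmbedRel r₁ ∧ NoRatEmbedRel r₂ ∧
        (∀ a b : α, a ≤ b ↔ (r₁ a b ∧ r₂ a b))) ↔
    ((∃ L : α → α → Prop,
        IsLinearOrder α L ∧
        (∀ a b : α, a ≤ b → L a b) ∧
        NoRatEmbedRel L ∧
        NonSeparating L) ∧
      (∀ e : ℚ → ℕ, Function.Injective e →
        (¬ ∃ f : ℚ → α, ∀ q q' : ℚ, f q ≤ f q' ↔ (q ≤ q' ∧ e q ≤ e q')) ∧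
        (¬ ∃ g : ℚ → α, ∀ q q' : ℚ, g q ≤ g q' ↔ (q' ≤ q ∧ e q' ≤ e q)))) := by
  constructor
  · rintro ⟨r₁, r₂, h₁, h₂, s₁, s₂, H⟩
    refine ⟨⟨r₁, h₁, fun a b h ↦ ((H a b).1 h).1, s₁, nonSeparating_of_inter h₂ H⟩,
      fun e he ↦ ⟨?_, ?_⟩⟩
    · simp only [H]
      exact not_exists_rat_map_of_noRatEmbedRel h₁ h₂ s₁ s₂ he
    · rintro ⟨g, hg⟩
      refine not_exists_rat_map_of_noRatEmbedRel (isLinearOrder_swap h₁) (isLinearOrder_swap h₂)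
        s₁.swap s₂.swap he ⟨g, fun q q' ↦ ?_⟩
      rw [← hg q' q, H]
  · rintro ⟨⟨L, hL, hext, hs, hsep⟩, hΩ⟩
    have hlin := isLinearOrder_conjRel hL hsep
    refine ⟨L, ConjRel L, hL, hlin, hs, ?_, le_iff_rel_and_conjRel hL hext⟩
    rintro ⟨f, hf⟩
    have hinj : Function.Injective f := fun q q' hq ↦ le_antisymm
      ((hf _ _).2 (hq ▸ hlin.refl _)) ((hf _ _).2 (hq ▸ hlin.refl _))
    have hle : ∀ q q', f q ≤ f q' ↔ (q ≤ q' ∧ L (f q) (f q')) := fun q q' ↦ by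
      rw [le_iff_rel_and_conjRel hL hext, ← hf, and_comm]
    by_cases hsc : NoRatEmbedRel fun q q' ↦ L (f q) (f q')
    · have hr := isLinearOrder_comap hL hinj
      obtain ⟨x, hx | hx⟩ := exists_containsRat_of_noRatEmbedRel hr hsc
      · obtain ⟨ψ, e, he, h⟩ := exists_rat_map_of_containsRat hr hx
        refine (hΩ e he).1 ⟨fun q ↦ f (ψ q), fun q q' ↦ ?_⟩
        rw [hle, ψ.le_iff_le, h]
      · have hx' : ContainsRat {z | Function.swap (fun q q' ↦ L (f q) (f q')) x z ∧
            ¬ ContainsRat (RelIcc (Function.swap fun q q' ↦ L (f q) (f q')) x z)} :=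
          hx.mono fun z hz ↦ ⟨hz.1, fun h ↦ hz.2 (h.mono fun w hw ↦ ⟨hw.2, hw.1⟩)⟩
        obtain ⟨ψ, e, he, h⟩ := exists_rat_map_of_containsRat (isLinearOrder_swap hr) hx'
        refine (hΩ (fun q ↦ e (-q)) (he.comp neg_injective)).2
          ⟨fun q ↦ f (ψ (-q)), fun q q' ↦ ?_⟩
        rw [hle, ψ.le_iff_le, neg_le_neg_iff, ← h]
    · obtain ⟨g, hg⟩ := not_not.1 hsc
      exact hs ⟨fun q ↦ f (g q), hg⟩
end
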